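/- Sufficient separability criterion 2: Let N ≥ 2, let σ be a Hermitian matrix on ℂ² ⊗ ℂ^N, and let α, β be reals satisfying α ≥ max(-1, β/2 - 1), β ≥ max(-1, α/2 - 1), and α² ≠ β². If the matrix (1/(α² - β²))·(α·σ - β·σ̃_A - ((α - β)/(2N + α + β))·Tr(σ)·𝟙_{2N}) is positive semidefinite, then σ is separable. -/

import Mathlib

open Matrix Kronecker
open scoped ComplexOrder

noncomputable section

/-- A Hermitian matrix on ℂ^M ⊗ ℂ^N is separable if it is a finite sum of Kronecker
products of positive semidefinite matrices. -/
def IsSeparableMat {M N : ℕ} (σ : Matrix (Fin M × Fin N) (Fin M × Fin N) ℂ) : Prop :=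
  ∃ (k : ℕ) (A : Fin k → Matrix (Fin M) (Fin M) ℂ) (B : Fin k → Matrix (Fin N) (Fin N) ℂ),
    (∀ i, (A i).PosSemidef) ∧ (∀ i, (B i).PosSemidef) ∧ σ = ∑ i, A i ⊗ₖ B i

/-- Partial transpose on the first (Alice) factor. -/
def ptA {M N : ℕ} (ρ : Matrix (Fin M × Fin N) (Fin M × Fin N) ℂ) :
    Matrix (Fin M × Fin N) (Fin M × Fin N) ℂ :=
  fun p q => ρ (q.1, p.2) (p.1, q.2)

/-- Partial transpose on the second (Bob) factor. -/
def ptB {M N : ℕ} (ρ : Matrix (Fin M × Fin N) (Fin M × Fin N) ℂ) :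
    Matrix (Fin M × Fin N) (Fin M × Fin N) ℂ :=
  fun p q => ρ (p.1, q.2) (q.1, p.2)

/-- The second Pauli matrix σ₂. -/
def pauli2 : Matrix (Fin 2) (Fin 2) ℂ := !![0, -Complex.I; Complex.I, 0]

/-- ρ̃_A = (σ₂ ⊗ 𝟙_N) ρ^{T_A} (σ₂ ⊗ 𝟙_N). -/
def tildeA {N : ℕ} (ρ : Matrix (Fin 2 × Fin N) (Fin 2 × Fin N) ℂ) :
    Matrix (Fin 2 × Fin N) (Fin 2 × Fin N) ℂ :=
  (pauli2 ⊗ₖ (1 : Matrix (Fin N) (Fin N) ℂ)) * ptA ρ *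
    (pauli2 ⊗ₖ (1 : Matrix (Fin N) (Fin N) ℂ))

end

namespace IsSeparableMat

variable {M N : ℕ}

theorem kronecker {A : Matrix (Fin M) (Fin M) ℂ} {B : Matrix (Fin N) (Fin N) ℂ}
    (hA : A.PosSemidef) (hB : B.PosSemidef) : IsSeparableMat (A ⊗ₖ B) :=
  ⟨1, fun _ => A, fun _ => B, fun _ => hA, fun _ => hB, by simp⟩

theorem zero : IsSeparableMat (0 : Matrix (Fin M × Fin N) (Fin M × Fin N) ℂ) :=
  ⟨0, fun _ => 0, fun _ => 0, fun i => i.elim0, fun i => i.elim0, by simp⟩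

theorem add {σ τ : Matrix (Fin M × Fin N) (Fin M × Fin N) ℂ}
    (hσ : IsSeparableMat σ) (hτ : IsSeparableMat τ) : IsSeparableMat (σ + τ) := by
  obtain ⟨k, A, B, hA, hB, rfl⟩ := hσ
  obtain ⟨l, C, D, hC, hD, rfl⟩ := hτ
  refine ⟨k + l, Fin.append A C, Fin.append B D, ?_, ?_, ?_⟩
  · intro i
    refine Fin.addCases (fun i => ?_) (fun i => ?_) i <;> simp [hA, hC]
  · intro i
    refine Fin.addCases (fun i => ?_) (fun i => ?_) i <;> simp [hB, hD]
  · simp [Fin.sum_univ_add]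

theorem smul {σ : Matrix (Fin M × Fin N) (Fin M × Fin N) ℂ}
    (hσ : IsSeparableMat σ) {c : ℂ} (hc : 0 ≤ c) : IsSeparableMat (c • σ) := by
  obtain ⟨k, A, B, hA, hB, rfl⟩ := hσ
  exact ⟨k, A, fun i => c • B i, hA, fun i => (hB i).smul hc, by
    simp [Finset.smul_sum, kronecker_smul]⟩

theorem sum {ι : Type*} (s : Finset ι) {σ : ι → Matrix (Fin M × Fin N) (Fin M × Fin N) ℂ}
    (h : ∀ i ∈ s, IsSeparableMat (σ i)) : IsSeparableMat (∑ i ∈ s, σ i) :=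
  Finset.sum_induction σ IsSeparableMat (fun _ _ => add) zero h

end IsSeparableMat

variable {N : ℕ}

theorem tildeA_apply (ρ : Matrix (Fin 2 × Fin N) (Fin 2 × Fin N) ℂ) (i k : Fin 2) (j l : Fin N) :
    tildeA ρ (i, j) (k, l) =
      (1 : Matrix (Fin 2) (Fin 2) ℂ) i k * (ρ (0, j) (0, l) + ρ (1, j) (1, l)) -
        ρ (i, j) (k, l) := by
  fin_cases i <;> fin_cases k <;>
    simp [tildeA, ptA, pauli2, Matrix.mul_apply, Fintype.sum_prod_type, Matrix.one_apply,
      kroneckerMap_apply] <;>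
    ring_nf <;> simp [Complex.I_sq]

theorem tildeA_add (ρ τ : Matrix (Fin 2 × Fin N) (Fin 2 × Fin N) ℂ) :
    tildeA (ρ + τ) = tildeA ρ + tildeA τ := by
  ext ⟨i, j⟩ ⟨k, l⟩
  simp only [tildeA_apply, Matrix.add_apply]
  ring

theorem tildeA_smul (c : ℂ) (ρ : Matrix (Fin 2 × Fin N) (Fin 2 × Fin N) ℂ) :
    tildeA (c • ρ) = c • tildeA ρ := by
  ext ⟨i, j⟩ ⟨k, l⟩
  simp only [tildeA_apply, Matrix.smul_apply, smul_eq_mul]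
  ring

theorem tildeA_one : tildeA (1 : Matrix (Fin 2 × Fin N) (Fin 2 × Fin N) ℂ) = 1 := by
  ext ⟨i, j⟩ ⟨k, l⟩
  fin_cases i <;> fin_cases k <;> simp [tildeA_apply, Matrix.one_apply]

theorem tildeA_tildeA (ρ : Matrix (Fin 2 × Fin N) (Fin 2 × Fin N) ℂ) :
    tildeA (tildeA ρ) = ρ := by
  ext ⟨i, j⟩ ⟨k, l⟩
  simp only [tildeA_apply, Matrix.one_apply_eq]
  ring

theorem trace_tildeA (ρ : Matrix (Fin 2 × Fin N) (Fin 2 × Fin N) ℂ) :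
    (tildeA ρ).trace = ρ.trace := by
  simp only [Matrix.trace, Matrix.diag, Fintype.sum_prod_type, tildeA_apply, Fin.sum_univ_two,
    Matrix.one_apply_eq, ← Finset.sum_add_distrib]
  exact Finset.sum_congr rfl fun j _ => by ring

theorem tildeA_kronecker (A : Matrix (Fin 2) (Fin 2) ℂ) (B : Matrix (Fin N) (Fin N) ℂ) :
    tildeA (A ⊗ₖ B) = (pauli2 * Aᵀ * pauli2) ⊗ₖ B := by
  have h : ptA (A ⊗ₖ B) = Aᵀ ⊗ₖ B := by
    ext ⟨i, j⟩ ⟨k, l⟩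
    simp [ptA]
  simp [tildeA, h, ← Matrix.mul_kronecker_mul]

theorem pauli2_isHermitian : pauli2.IsHermitian := by
  ext i j
  fin_cases i <;> fin_cases j <;> simp [pauli2]

theorem IsSeparableMat.tildeA {σ : Matrix (Fin 2 × Fin N) (Fin 2 × Fin N) ℂ}
    (hσ : IsSeparableMat σ) : IsSeparableMat (tildeA σ) := by
  obtain ⟨k, A, B, hA, hB, rfl⟩ := hσ
  refine ⟨k, fun i => pauli2 * (A i)ᵀ * pauli2, B, fun i => ?_, hB, ?_⟩
  · simpa [pauli2_isHermitian.eq] using (hA i).transpose.mul_mul_conjTranspose_same pauli2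
  · let T : Matrix (Fin 2 × Fin N) (Fin 2 × Fin N) ℂ →+ Matrix (Fin 2 × Fin N) (Fin 2 × Fin N) ℂ :=
      AddMonoidHom.mk' _root_.tildeA tildeA_add
    simp only [← tildeA_kronecker]
    exact map_sum T (fun i => A i ⊗ₖ B i) Finset.univ

/-- The average of `(f + ω g)(f + ω g)ᴴ ⊗ (u + ω̄ v)(u + ω̄ v)ᴴ` over the fourth roots of unity. -/
theorem isSeparableMat_phase_average (f g : Fin 2 → ℂ) (u v : Fin N → ℂ) :
    IsSeparableMat
      ((vecMulVec f (star f) + vecMulVec g (star g)) ⊗ₖ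
          (vecMulVec u (star u) + vecMulVec v (star v)) +
        vecMulVec f (star g) ⊗ₖ vecMulVec u (star v) +
        vecMulVec g (star f) ⊗ₖ vecMulVec v (star u)) := by
  have key (ω : ℂ) : IsSeparableMat ((4⁻¹ : ℂ) •
      (vecMulVec (f + ω • g) (star (f + ω • g)) ⊗ₖ
        vecMulVec (u + star ω • v) (star (u + star ω • v)))) :=
    (IsSeparableMat.kronecker (posSemidef_vecMulVec_self_star _)
      (posSemidef_vecMulVec_self_star _)).smul (by positivity)
  convert (((key 1).add (key (-1))).add (key Complex.I)).add (key (-Complex.I)) using 1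
  ext ⟨i, j⟩ ⟨k, l⟩
  simp only [Matrix.add_apply, Matrix.smul_apply, kroneckerMap_apply, vecMulVec_apply,
    Pi.add_apply, Pi.smul_apply, Pi.star_apply, smul_eq_mul, star_add, star_mul', star_neg,
    star_one, RCLike.star_def, Complex.conj_I]
  ring_nf
  simp only [Complex.I_sq, Complex.I_pow_four]
  ring

theorem dotProduct_self_star_mul_inv_mul (u : Fin N → ℂ) (j : Fin N) :
    (u ⬝ᵥ star u) * (u ⬝ᵥ star u)⁻¹ * u j = u j := by
  by_cases h : u ⬝ᵥ star u = 0
  · rw [dotProduct_self_star_eq_zero] at h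
    simp [h]
  · simp [h]

theorem star_dotProduct_star_swap {n : Type*} [Fintype n] (u v : n → ℂ) :
    star (u ⬝ᵥ star v) = v ⬝ᵥ star u := by
  simp [dotProduct, mul_comm]

theorem posSemidef_one_sub_proj_sub_proj (u v : Fin N → ℂ) (h : u ⬝ᵥ star v = 0) :
    (1 - (u ⬝ᵥ star u)⁻¹ • vecMulVec u (star u) -
      (v ⬝ᵥ star v)⁻¹ • vecMulVec v (star v)).PosSemidef := by
  have h' : v ⬝ᵥ star u = 0 := by
    rw [← star_dotProduct_star_swap, h, star_zero]
  have idem (w : Fin N → ℂ) : ((w ⬝ᵥ star w)⁻¹ * ((w ⬝ᵥ star w)⁻¹ * (w ⬝ᵥ star w))) =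
      (w ⬝ᵥ star w)⁻¹ := by
    by_cases h : w ⬝ᵥ star w = 0
    · simp [h]
    · field_simp
  set P := 1 - (u ⬝ᵥ star u)⁻¹ • vecMulVec u (star u) -
      (v ⬝ᵥ star v)⁻¹ • vecMulVec v (star v) with hP
  have hH : Pᴴ = P := by
    simp only [hP, conjTranspose_sub, conjTranspose_one, conjTranspose_smul, star_inv₀,
      star_dotProduct_star_swap, conjTranspose_vecMulVec, star_star]
  have hPP : P * P = P := by
    have c (w : Fin N → ℂ) : star w ⬝ᵥ w = w ⬝ᵥ star w := dotProduct_comm _ _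
    have c1 : star u ⬝ᵥ v = 0 := by rw [dotProduct_comm, h']
    have c2 : star v ⬝ᵥ u = 0 := by rw [dotProduct_comm, h]
    simp only [hP, sub_mul, mul_sub, one_mul, mul_one, smul_mul_assoc, mul_smul_comm,
      vecMulVec_mul_vecMulVec, c, c1, c2, smul_smul, vecMulVec_smul, zero_smul]
    simp [smul_sub, smul_smul, idem]
  rw [← hPP]
  nth_rewrite 1 [← hH]
  exact posSemidef_conjTranspose_mul_self P

/-- Schmidt decomposition of a vector of `ℂ² ⊗ ℂ^N`. -/
theorem exists_schmidt (ψ : Fin 2 × Fin N → ℂ) :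
    ∃ (f g : Fin 2 → ℂ) (u v : Fin N → ℂ),
      vecMulVec f (star f) + vecMulVec g (star g) = 1 ∧ u ⬝ᵥ star v = 0 ∧
      f ⬝ᵥ star f = 1 ∧ g ⬝ᵥ star g = 1 ∧ f ⬝ᵥ star g = 0 ∧
      ∀ i j, ψ (i, j) = f i * u j + g i * v j := by
  let W : Matrix (Fin 2) (Fin N) ℂ := Matrix.of fun i j => ψ (i, j)
  have hG := isHermitian_mul_conjTranspose_self W
  let U : Matrix (Fin 2) (Fin 2) ℂ := hG.eigenvectorUnitary
  have hU : U * Uᴴ = 1 := Unitary.mul_star_self_of_mem hG.eigenvectorUnitary.2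
  have hU' : Uᴴ * U = 1 := Unitary.star_mul_self_of_mem hG.eigenvectorUnitary.2
  have hD : (Uᴴ * W) * (Uᴴ * W)ᴴ = diagonal (RCLike.ofReal ∘ hG.eigenvalues) := by
    have := hG.conjStarAlgAut_star_eigenvectorUnitary
    rw [Unitary.conjStarAlgAut_star_apply] at this
    rw [← this, conjTranspose_mul, conjTranspose_conjTranspose]
    simp only [Matrix.mul_assoc]
    rfl
  have hW : W = U * (Uᴴ * W) := by rw [← Matrix.mul_assoc, hU, Matrix.one_mul]
  refine ⟨fun i => U i 0, fun i => U i 1, (Uᴴ * W) 0, (Uᴴ * W) 1, ?_, ?_, ?_, ?_, ?_, ?_⟩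
  · rw [← hU]
    ext i j
    simp [Matrix.mul_apply, vecMulVec_apply]
  · simpa [Matrix.mul_apply, dotProduct, mul_comm] using congrFun (congrFun hD 0) 1
  · simpa [Matrix.mul_apply, dotProduct, mul_comm] using congrFun (congrFun hU' 0) 0
  · simpa [Matrix.mul_apply, dotProduct, mul_comm] using congrFun (congrFun hU' 1) 1
  · simpa [Matrix.mul_apply, dotProduct, mul_comm] using congrFun (congrFun hU' 1) 0
  · intro i j
    have := congrFun (congrFun hW i) j
    rw [Matrix.mul_apply, Fin.sum_univ_two] at this
    exact this

/-- The four extreme cases, for a rank one matrix. -/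
theorem isSeparableMat_vecMulVec (ψ : Fin 2 × Fin N → ℂ) {X : Matrix _ _ ℂ}
    (hX : X = vecMulVec ψ (star ψ)) :
    IsSeparableMat (X + tildeA X) ∧
    IsSeparableMat (X.trace • 1 - X - tildeA X) ∧
    IsSeparableMat (X.trace • 1 - tildeA X) ∧
    IsSeparableMat ((2 : ℂ) • X + tildeA X) := by
  obtain ⟨f, g, u, v, h1, huv, hff, hgg, hfg, hψ⟩ := exists_schmidt ψ
  have hgf : g ⬝ᵥ star f = 0 := by
    rw [← star_dotProduct_star_swap, hfg, star_zero]
  have hs := dotProduct_self_star_nonneg u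
  have ht := dotProduct_self_star_nonneg v
  have hu := dotProduct_self_star_mul_inv_mul u
  have hv := dotProduct_self_star_mul_inv_mul v
  have hv' (j : Fin N) : (v ⬝ᵥ star v) * (v ⬝ᵥ star v)⁻¹ * star (v j) = star (v j) := by
    simpa only [star_mul', star_inv₀, star_dotProduct_star_swap] using congrArg star (hv j)
  have hu' (j : Fin N) : (u ⬝ᵥ star u) * (u ⬝ᵥ star u)⁻¹ * star (u j) = star (u j) := by
    simpa only [star_mul', star_inv₀, star_dotProduct_star_swap] using congrArg star (hu j)
  have hP := posSemidef_one_sub_proj_sub_proj u v huv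
  have hPu := posSemidef_vecMulVec_self_star u
  have hPv := posSemidef_vecMulVec_self_star v
  have hPf := posSemidef_vecMulVec_self_star f
  have hPg := posSemidef_vecMulVec_self_star g
  have hXX : X = vecMulVec f (star f) ⊗ₖ vecMulVec u (star u) +
      vecMulVec g (star g) ⊗ₖ vecMulVec v (star v) +
      vecMulVec f (star g) ⊗ₖ vecMulVec u (star v) +
      vecMulVec g (star f) ⊗ₖ vecMulVec v (star u) := by
    ext ⟨i, j⟩ ⟨k, l⟩
    simp only [hX, vecMulVec_apply, Pi.star_apply, hψ, star_add, star_mul', Matrix.add_apply,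
      kroneckerMap_apply]
    ring
  have htr : X.trace = u ⬝ᵥ star u + v ⬝ᵥ star v := by
    simp [hXX, trace_kronecker, trace_vecMulVec, hff, hgg, hfg, hgf]
  simp only [dotProduct, Fin.sum_univ_two, Pi.star_apply] at hff hgg hfg hgf
  have hK : tildeA X = 1 ⊗ₖ (vecMulVec u (star u) + vecMulVec v (star v)) - X := by
    ext ⟨i, j⟩ ⟨k, l⟩
    rw [tildeA_apply, Matrix.sub_apply, kroneckerMap_apply]
    congr 2
    simp only [hX, vecMulVec_apply, Pi.star_apply, hψ, star_add, star_mul', Matrix.add_apply]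
    linear_combination u j * star (u l) * hff + v j * star (v l) * hgg +
      u j * star (v l) * hfg + v j * star (u l) * hgf
  have hss : star (u ⬝ᵥ star u) = u ⬝ᵥ star u := star_dotProduct_star_swap u u
  have htt : star (v ⬝ᵥ star v) = v ⬝ᵥ star v := star_dotProduct_star_swap v v
  generalize u ⬝ᵥ star u = s at *
  generalize v ⬝ᵥ star v = t at *
  have hR : ((s + t) • (1 - s⁻¹ • vecMulVec u (star u) - t⁻¹ • vecMulVec v (star v))).PosSemidef :=
    hP.smul (add_nonneg hs ht)
  have hs' : 0 ≤ s⁻¹ := inv_nonneg.2 hs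
  have ht' : 0 ≤ t⁻¹ := inv_nonneg.2 ht
  rw [hK, htr]
  refine ⟨?_, ?_, ?_, ?_⟩
  · convert IsSeparableMat.kronecker (PosSemidef.one (n := Fin 2) (R := ℂ)) (hPu.add hPv) using 1
    abel
  · convert IsSeparableMat.kronecker (PosSemidef.one (n := Fin 2) (R := ℂ)) ((hR.add
      (hPu.smul (mul_nonneg hs' ht))).add (hPv.smul (mul_nonneg ht' hs))) using 1
    ext ⟨i, j⟩ ⟨k, l⟩
    simp only [← one_kronecker_one, Matrix.sub_apply, Matrix.add_apply, Matrix.smul_apply,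
      kroneckerMap_apply, vecMulVec_apply, Pi.star_apply, smul_eq_mul]
    linear_combination (1 : Matrix (Fin 2) (Fin 2) ℂ) i k *
      (star (u l) * hu j + star (v l) * hv j)
  · convert ((IsSeparableMat.kronecker hPf (hR.add hPu)).add
      (IsSeparableMat.kronecker hPg (hR.add hPv))).add
      ((isSeparableMat_phase_average f g (t • u) (s • v)).smul (mul_nonneg hs' ht')) using 1
    rw [hXX, ← one_kronecker_one, ← h1]
    ext ⟨i, j⟩ ⟨k, l⟩
    simp only [Matrix.sub_apply, Matrix.add_apply, Matrix.smul_apply, kroneckerMap_apply,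
      vecMulVec_apply, Pi.star_apply, Pi.smul_apply, smul_eq_mul, star_mul', hss, htt]
    linear_combination (f i * star (f k) + g i * star (g k)) *
      (star (u l) * hu j + star (v l) * hv j - s⁻¹ * u j * star (u l) * mul_inv_mul_cancel t -
        t⁻¹ * v j * star (v l) * mul_inv_mul_cancel s) -
      f i * star (g k) * (t * t⁻¹ * star (v l) * hu j + u j * hv' l) -
      g i * star (f k) * (s * s⁻¹ * star (u l) * hv j + v j * hu' l)
  · convert ((IsSeparableMat.kronecker hPf hPu).add (IsSeparableMat.kronecker hPg hPv)).add
      (isSeparableMat_phase_average f g u v) using 1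
    rw [← h1]
    nth_rewrite 2 [hXX]
    rw [two_smul, hXX]
    abel

theorem IsSeparableMat.of_posSemidef_of_le {X : Matrix (Fin 2 × Fin N) (Fin 2 × Fin N) ℂ}
    (hX : X.PosSemidef) {α β : ℝ} (hβ : -1 ≤ β) (hαβ : α / 2 - 1 ≤ β) (hle : β ≤ α) :
    IsSeparableMat (X.trace • 1 + (α : ℂ) • X + (β : ℂ) • _root_.tildeA X) := by
  obtain ⟨m, v, rfl⟩ := posSemidef_iff_eq_sum_vecMulVec.1 hX
  have key (i : Fin m) : IsSeparableMat ((vecMulVec (v i) (star (v i))).trace • 1 +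
      (α : ℂ) • vecMulVec (v i) (star (v i)) +
      (β : ℂ) • _root_.tildeA (vecMulVec (v i) (star (v i)))) := by
    obtain ⟨hK, hE, hP, hQ⟩ := isSeparableMat_vecMulVec (v i) rfl
    rcases le_total (α - β) 1 with h | h
    · have a1 : (0 : ℂ) ≤ ((1 - (α - β) : ℝ) : ℂ) := by exact_mod_cast (by linarith)
      have a2 : (0 : ℂ) ≤ ((α - β : ℝ) : ℂ) := by exact_mod_cast (by linarith)
      have a3 : (0 : ℂ) ≤ ((β + 1 : ℝ) : ℂ) := by exact_mod_cast (by linarith)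
      convert ((hE.smul a1).add (hP.smul a2)).add (hK.smul a3) using 1
      push_cast
      module
    · have a1 : (0 : ℂ) ≤ ((α - β - 1 : ℝ) : ℂ) := by exact_mod_cast (by linarith)
      have a2 : (0 : ℂ) ≤ ((β + 1 - (α - β - 1) : ℝ) : ℂ) := by exact_mod_cast (by linarith)
      convert (hP.add (hQ.smul a1)).add (hK.smul a2) using 1
      push_cast
      module
  let T : Matrix (Fin 2 × Fin N) (Fin 2 × Fin N) ℂ →+ Matrix (Fin 2 × Fin N) (Fin 2 × Fin N) ℂ :=
    AddMonoidHom.mk' _root_.tildeA tildeA_add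
  have hT : _root_.tildeA (∑ i, vecMulVec (v i) (star (v i))) =
      ∑ i, _root_.tildeA (vecMulVec (v i) (star (v i))) :=
    map_sum T (fun i => vecMulVec (v i) (star (v i))) Finset.univ
  convert IsSeparableMat.sum Finset.univ fun i _ => key i using 1
  rw [hT, trace_sum]
  simp only [Finset.sum_add_distrib, Finset.smul_sum, Finset.sum_smul]

theorem IsSeparableMat.of_posSemidef {X : Matrix (Fin 2 × Fin N) (Fin 2 × Fin N) ℂ}
    (hX : X.PosSemidef) {α β : ℝ} (hα : -1 ≤ α) (hβα : β / 2 - 1 ≤ α) (hβ : -1 ≤ β)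
    (hαβ : α / 2 - 1 ≤ β) :
    IsSeparableMat (X.trace • 1 + (α : ℂ) • X + (β : ℂ) • _root_.tildeA X) := by
  rcases le_total β α with h | h
  · exact .of_posSemidef_of_le hX hβ hαβ h
  · convert (IsSeparableMat.of_posSemidef_of_le hX hα hβα h).tildeA using 1
    simp only [tildeA_add, tildeA_smul, tildeA_one, tildeA_tildeA]
    abel

/-- Sufficient separability criterion 2. -/
theorem stmt5 {N : ℕ} (hN : 2 ≤ N)
    (σ : Matrix (Fin 2 × Fin N) (Fin 2 × Fin N) ℂ) (hσ : σ.IsHermitian)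
    (α β : ℝ) (hα : α ≥ max (-1) (β / 2 - 1)) (hβ : β ≥ max (-1) (α / 2 - 1))
    (hαβ : α ^ 2 ≠ β ^ 2)
    (hpos : ((((α ^ 2 - β ^ 2 : ℝ) : ℂ))⁻¹ •
        ((α : ℂ) • σ - (β : ℂ) • tildeA σ -
          ((((α - β) / (2 * (N : ℝ) + α + β) : ℝ) : ℂ) * σ.trace) •
            (1 : Matrix (Fin 2 × Fin N) (Fin 2 × Fin N) ℂ))).PosSemidef) :
    IsSeparableMat σ := by
  obtain ⟨hα, hβα⟩ := max_le_iff.1 hα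
  obtain ⟨hβ, hαβ'⟩ := max_le_iff.1 hβ
  have hN' : (2 : ℝ) ≤ N := by exact_mod_cast hN
  have hD : 2 * (N : ℝ) + α + β ≠ 0 := by linarith
  have hd : α ^ 2 - β ^ 2 ≠ 0 := sub_ne_zero.2 hαβ
  have hD' : 2 * (N : ℂ) + α + β ≠ 0 := by exact_mod_cast hD
  have hd' : (α : ℂ) ^ 2 - (β : ℂ) ^ 2 ≠ 0 := by exact_mod_cast hd
  convert IsSeparableMat.of_posSemidef hpos hα hβα hβ hαβ' using 1
  simp only [sub_eq_add_neg, ← neg_smul, tildeA_add, tildeA_smul, tildeA_one, tildeA_tildeA,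
    trace_add, trace_smul, trace_tildeA, trace_one, Fintype.card_prod, Fintype.card_fin,
    smul_eq_mul]
  push_cast
  rw [sub_eq_add_neg] at hd'
  match_scalars <;> field_simp <;> ring
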